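/- Fix an integer C ≥ 2. Let n = n(ν) and N = N(ν) be sequences of positive integers with N → ∞, n ≤ CN − 1, CN − n = o(N), and λ_0 = o(N^{1/C}), where λ_0 = λ_0(n/N) is the unique positive solution of λ g′(λ)/g(λ) = n/N. For 0 ≤ m ≤ C−2 set μ_m = N λ_0^m / (g(λ_0) m!). Then, in the uniform allocation model, the (C−1)-dimensional random vector with coordinates (X_m − μ_m)/√μ_m, m = 0, 1, …, C−2, converges in distribution to the standard (C−1)-dimensional normal distribution N(0, I_{C−1}); in particular the numbers of bins containing exactly m balls, for 0 ≤ m ≤ C−2, are asymptotically independent Gaussians. -/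

import Mathlib

open MeasureTheory ProbabilityTheory Filter Finset
open scoped BigOperators

/-- The standard `r`-dimensional Gaussian measure `N(0, I_r)` on `Fin r → ℝ`. -/
noncomputable def stdGaussian (r : ℕ) : Measure (Fin r → ℝ) :=
  Measure.pi fun _ => gaussianReal 0 1

/-- Placements of `n` distinguishable balls into `N` distinguishable bins with
no bin containing more than `C` balls. -/
def validPlacements (n N C : ℕ) : Finset (Fin n → Fin N) :=
  Finset.univ.filter fun f => ∀ j, (Finset.univ.filter fun i => f i = j).card ≤ C

/-- `binCount f m` is the number of bins containing exactly `m` balls under placement `f`. -/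
def binCount {n N : ℕ} (f : Fin n → Fin N) (m : ℕ) : ℕ :=
  (Finset.univ.filter fun j => (Finset.univ.filter fun i => f i = j).card = m).card

/-- `g(λ) = ∑_{k=0}^C λ^k / k!`. -/
noncomputable def gfun (C : ℕ) (x : ℝ) : ℝ :=
  ∑ k ∈ Finset.range (C + 1), x ^ k / (Nat.factorial k)

theorem exists_fun_card_fiber_eq {α β : Type*} [Fintype α] [Fintype β] [DecidableEq β]
    (k : β → ℕ) (hk : ∑ b, k b = Fintype.card α) :
    ∃ f : α → β, ∀ b, #{a | f a = b} = k b := by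
  have hcard : Fintype.card α = Fintype.card (Σ b, Fin (k b)) := by simp [hk]
  let e := Fintype.equivOfCardEq hcard
  refine ⟨fun a => (e a).1, fun b => ?_⟩
  rw [← Fintype.card_subtype]
  have e2 : {a // (e a).1 = b} ≃ {s : Σ b, Fin (k b) // s.1 = b} :=
    e.subtypeEquiv fun a => Iff.rfl
  rw [Fintype.card_congr (e2.trans (Equiv.sigmaSubtype b)), Fintype.card_fin]

theorem exists_perm_comp_eq {α β : Type*} [Fintype α] [DecidableEq β]
    (f g : α → β) (h : ∀ b, #{a | f a = b} = #{a | g a = b}) :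
    ∃ σ : Equiv.Perm α, f ∘ σ = g := by
  have e (b : β) : {a // g a = b} ≃ {a // f a = b} :=
    Fintype.equivOfCardEq (by rw [Fintype.card_subtype, Fintype.card_subtype, h b])
  refine ⟨(Equiv.sigmaFiberEquiv g).symm.trans
    ((Equiv.sigmaCongrRight e).trans (Equiv.sigmaFiberEquiv f)), ?_⟩
  ext a
  exact (e (g a) ⟨a, rfl⟩).2

/-- The number of functions with prescribed fiber sizes is a multinomial coefficient. -/
theorem card_fun_fiber_mul_prod_factorial {α β : Type*} [Fintype α] [DecidableEq α]
    [Fintype β] [DecidableEq β] (k : β → ℕ) (hk : ∑ b, k b = Fintype.card α) :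
    #{f : α → β | ∀ b, #{a | f a = b} = k b} * ∏ b, (k b).factorial =
      (Fintype.card α).factorial := by
  obtain ⟨f, hf⟩ := exists_fun_card_fiber_eq k hk
  have hmaps : Set.MapsTo (fun σ : Equiv.Perm α => f ∘ σ) (univ : Finset (Equiv.Perm α))
      ({g : α → β | ∀ b, #{a | g a = b} = k b} : Finset (α → β)) := by
    intro σ _
    simp only [coe_filter, mem_univ, true_and, Set.mem_ofPred_eq]
    intro b
    rw [← hf b]
    exact card_bij (fun a _ => σ a) (by simp) (by simp)
      (fun a ha => ⟨σ.symm a, by simpa using ha⟩)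
  rw [← Fintype.card_perm, ← card_univ, card_eq_sum_card_fiberwise hmaps, ← smul_eq_mul,
    ← sum_const]
  refine sum_congr rfl fun g hg => ?_
  obtain ⟨τ, rfl⟩ := exists_perm_comp_eq f g fun b => by
    rw [hf b, (mem_filter.1 hg).2 b]
  have hstab := DomMulAct.stabilizer_card f
  rw [Fintype.card_subtype] at hstab
  simp only [Fintype.card_subtype, hf] at hstab
  rw [← hstab]
  refine card_bij (fun σ _ => σ * τ) (fun σ hσ => ?_) (by simp) (fun σ hσ => ⟨σ * τ⁻¹, ?_, by simp⟩)
  · simp only [mem_filter, mem_univ, true_and] at hσ ⊢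
    rw [Equiv.Perm.coe_mul, ← Function.comp_assoc, hσ]
  · simp only [mem_filter, mem_univ, true_and] at hσ ⊢
    rw [Equiv.Perm.coe_mul, ← Function.comp_assoc, hσ, Function.comp_assoc, ← Equiv.Perm.coe_mul]
    simp

theorem sum_binCount_smul {n N C : ℕ} {f : Fin n → Fin N} (hf : f ∈ validPlacements n N C)
    (w : ℕ → ℕ) :
    ∑ m : Fin (C + 1), w m * binCount f m = ∑ j, w #{i | f i = j} := by
  have hle : ∀ j, #{i | f i = j} ≤ C := (mem_filter.1 hf).2
  have hmaps : Set.MapsTo (fun j => #{i | f i = j}) (univ : Finset (Fin N))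
      (range (C + 1) : Finset ℕ) := fun j _ => by
    simpa using Nat.lt_succ_of_le (hle j)
  rw [Fin.sum_univ_eq_sum_range (fun m => w m * binCount f m), ← sum_fiberwise_of_maps_to hmaps]
  refine sum_congr rfl fun m _ => ?_
  rw [sum_congr rfl (g := fun _ => w m) (fun j hj => by rw [(mem_filter.1 hj).2]), sum_const,
    smul_eq_mul, mul_comm, binCount]

theorem sum_binCount {n N C : ℕ} {f : Fin n → Fin N} (hf : f ∈ validPlacements n N C) :
    ∑ m : Fin (C + 1), binCount f m = N := by
  simpa using sum_binCount_smul hf fun _ => 1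

theorem sum_mul_binCount {n N C : ℕ} {f : Fin n → Fin N} (hf : f ∈ validPlacements n N C) :
    ∑ m : Fin (C + 1), (m : ℕ) * binCount f m = n := by
  rw [sum_binCount_smul hf fun m => m]
  simpa using (card_eq_sum_card_fiberwise (f := f) (s := univ) (t := univ) (by simp)).symm

/-- The number of placements with prescribed numbers of bins of each occupancy. -/
theorem card_validPlacements_binCount_eq {n N C : ℕ} (x : Fin (C + 1) → ℕ)
    (hN : ∑ m, x m = N) (hn : ∑ m : Fin (C + 1), (m : ℕ) * x m = n) :
    #{f ∈ validPlacements n N C | ∀ m : Fin (C + 1), binCount f m = x m} *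
      ((∏ m, (x m).factorial) * ∏ m : Fin (C + 1), (m : ℕ).factorial ^ x m) =
      n.factorial * N.factorial := by
  let occ : (Fin n → Fin N) → Fin N → Fin (C + 1) := fun f j =>
    ⟨min #{i | f i = j} C, Nat.lt_succ_of_le (min_le_right _ _)⟩
  let T : Finset (Fin N → Fin (C + 1)) := {κ | ∀ m, #{j | κ j = m} = x m}
  have hocc {f : Fin n → Fin N} (hf : f ∈ validPlacements n N C) (j : Fin N) :
      (occ f j : ℕ) = #{i | f i = j} := min_eq_left ((mem_filter.1 hf).2 j)
  have hbin {f : Fin n → Fin N} (hf : f ∈ validPlacements n N C) (m : Fin (C + 1)) :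
      #{j | occ f j = m} = binCount f m := by
    rw [binCount]
    congr 1
    ext j
    simp [Fin.ext_iff, hocc hf]
  have hmaps : Set.MapsTo occ
      ({f ∈ validPlacements n N C | ∀ m : Fin (C + 1), binCount f m = x m} : Finset _) T := by
    intro f hf
    obtain ⟨hf, hfx⟩ := mem_filter.1 (mem_coe.1 hf)
    exact mem_coe.2 (mem_filter.2 ⟨mem_univ _, fun m => by rw [hbin hf, hfx]⟩)
  have hT : #T * ∏ m, (x m).factorial = N.factorial := by
    have h := card_fun_fiber_mul_prod_factorial (α := Fin N) x (by simpa using hN)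
    rw [Fintype.card_fin] at h
    convert! h
  rw [← hT, mul_left_comm, mul_comm (∏ m, (x m).factorial), ← mul_assoc]
  congr 1
  rw [card_eq_sum_card_fiberwise hmaps, sum_mul, mul_comm, ← smul_eq_mul, ← sum_const]
  refine sum_congr rfl fun κ hκ => ?_
  have hκx : ∀ m, #{j | κ j = m} = x m := (mem_filter.1 hκ).2
  have hsum : ∑ j, (κ j : ℕ) = Fintype.card (Fin n) := by
    rw [Fintype.card_fin, ← hn, ← sum_fiberwise univ κ]
    refine sum_congr rfl fun m _ => ?_
    rw [sum_congr rfl (g := fun _ => (m : ℕ)) (fun j hj => by rw [(mem_filter.1 hj).2]), sum_const,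
      hκx, smul_eq_mul, mul_comm]
  have hprod : ∏ j, (κ j : ℕ).factorial = ∏ m : Fin (C + 1), (m : ℕ).factorial ^ x m := by
    rw [← prod_fiberwise univ κ]
    refine prod_congr rfl fun m _ => ?_
    rw [prod_congr rfl (g := fun _ => (m : ℕ).factorial)
      (fun j hj => by rw [(mem_filter.1 hj).2]), prod_const, hκx]
  have hfib := card_fun_fiber_mul_prod_factorial (α := Fin n) (fun j => (κ j : ℕ)) hsum
  rw [Fintype.card_fin, hprod] at hfib
  rw [← hfib]
  congr 2
  ext f
  simp only [mem_filter, mem_univ, true_and]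
  constructor
  · rintro ⟨⟨hf, -⟩, rfl⟩ j
    exact (hocc hf j).symm
  · intro hf
    have hv : f ∈ validPlacements n N C :=
      mem_filter.2 ⟨mem_univ _, fun j => by rw [hf]; exact Nat.lt_succ_iff.1 (κ j).2⟩
    have hoccκ : occ f = κ := funext fun j => Fin.ext (by rw [hocc hv, hf])
    exact ⟨⟨hv, fun m => by rw [← hbin hv, hoccκ, hκx]⟩, hoccκ⟩

/-- In terms of the tilted means `N x ^ m / (G m!)`, the number of placements with a prescribed
profile is, up to a constant, a product of Poisson weights. -/
theorem card_validPlacements_binCount_eq_prod {n N C : ℕ} (x : Fin (C + 1) → ℕ)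
    (hN : ∑ m, x m = N) (hn : ∑ m : Fin (C + 1), (m : ℕ) * x m = n) (hNpos : 0 < N)
    {t G : ℝ} (ht : 0 < t) (hG : 0 < G) :
    (#{f ∈ validPlacements n N C | ∀ m : Fin (C + 1), binCount f m = x m} : ℝ) =
      n.factorial * N.factorial * (G / N) ^ N / t ^ n *
        ∏ m : Fin (C + 1), (N * t ^ (m : ℕ) / (G * (m : ℕ).factorial)) ^ x m /
          (x m).factorial := by
  have hcount := congrArg (Nat.cast (R := ℝ)) (card_validPlacements_binCount_eq x hN hn)
  push_cast at hcount
  have hNpos' : (0 : ℝ) < N := by exact_mod_cast hNpos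
  have hprod : ∏ m : Fin (C + 1), (N * t ^ (m : ℕ) / (G * (m : ℕ).factorial)) ^ x m /
      ((x m).factorial : ℝ) = (N / G) ^ N * t ^ n /
        ((∏ m, ((x m).factorial : ℝ)) * ∏ m : Fin (C + 1), ((m : ℕ).factorial : ℝ) ^ x m) := by
    rw [prod_div_distrib, mul_comm (∏ m, ((x m).factorial : ℝ)), ← div_div]
    congr 1
    have hterm : ∀ m : Fin (C + 1), (N * t ^ (m : ℕ) / (G * (m : ℕ).factorial)) ^ x m =
        (N / G) ^ x m * t ^ ((m : ℕ) * x m) / ((m : ℕ).factorial : ℝ) ^ x m := fun m => by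
      rw [pow_mul, ← mul_pow, ← div_pow]
      congr 1
      field_simp
    rw [prod_congr rfl fun m _ => hterm m, prod_div_distrib, prod_mul_distrib,
      prod_pow_eq_pow_sum, prod_pow_eq_pow_sum, hN, hn]
  have hA : (∏ m, ((x m).factorial : ℝ)) ≠ 0 :=
    prod_ne_zero_iff.2 fun m _ => by positivity
  have hB : (∏ m : Fin (C + 1), ((m : ℕ).factorial : ℝ) ^ x m) ≠ 0 :=
    prod_ne_zero_iff.2 fun m _ => by positivity
  rw [hprod, ← hcount, div_pow, div_pow]
  field_simp

open scoped NNReal in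
theorem hasSum_poisson_sq_sub (a : ℝ≥0) :
    HasSum (fun k : ℕ => Real.exp (-a) * (a : ℝ) ^ k / k.factorial * ((k : ℝ) - a) ^ 2) a := by
  have h0 := hasSum_one_poissonMeasure a
  have h1 : HasSum (fun k : ℕ => Real.exp (-a) * (a : ℝ) ^ k / k.factorial * k) a := by
    rw [← hasSum_nat_add_iff' 1]
    convert! h0.mul_left (a : ℝ) using 1
    · ext k
      rw [Nat.factorial_succ]
      push_cast
      field_simp
      ring
    · simp
  have h2 : HasSum (fun k : ℕ => Real.exp (-a) * (a : ℝ) ^ k / k.factorial * (k * (k - 1)))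
      ((a : ℝ) * a) := by
    rw [← hasSum_nat_add_iff' 1]
    convert! h1.mul_left (a : ℝ) using 1
    · ext k
      rw [Nat.factorial_succ]
      push_cast
      field_simp
      ring
    · simp
  convert! (h2.add (h1.mul_left (1 - 2 * (a : ℝ)))).add (h0.mul_left ((a : ℝ) ^ 2)) using 1
  · ext k; ring
  · ring

open scoped NNReal in
theorem integrable_poissonMeasure_sq_sub (a : ℝ≥0) :
    Integrable (fun k : ℕ => ((k : ℝ) - a) ^ 2) (poissonMeasure a) := by
  rw [integrable_poissonMeasure_iff]
  simpa using (hasSum_poisson_sq_sub a).summable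

open scoped NNReal in
/-- The variance of the Poisson distribution. -/
theorem integral_poissonMeasure_sq_sub (a : ℝ≥0) :
    ∫ k : ℕ, ((k : ℝ) - a) ^ 2 ∂poissonMeasure a = a := by
  rw [integral_poissonMeasure]
  simpa using (hasSum_poisson_sq_sub a).tsum_eq

open scoped NNReal in
/-- The law of the standardized Poisson variable `(Z - a) / √a`. -/
noncomputable def standardizedPoisson (a : ℝ≥0) : ProbabilityMeasure ℝ :=
  ⟨(poissonMeasure a).map fun k : ℕ => ((k : ℝ) - a) / √(a : ℝ),
    Measure.isProbabilityMeasure_map .of_discrete⟩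

open scoped NNReal in
theorem charFun_standardizedPoisson (a : ℝ≥0) (t : ℝ) :
    charFun (standardizedPoisson a : Measure ℝ) t =
      Complex.exp (a * (Complex.exp ((t / √(a : ℝ) : ℝ) * Complex.I) - 1
        - (t / √(a : ℝ) : ℝ) * Complex.I)) := by
  have h := charFun_map_cast_poissonMeasure a (t / √(a : ℝ))
  rw [charFun_apply, integral_map .of_discrete (by fun_prop)] at h
  simp only [standardizedPoisson, ProbabilityMeasure.coe_mk]
  rw [charFun_apply, integral_map .of_discrete (by fun_prop), mul_sub, Complex.exp_sub, ← h,
    div_eq_mul_inv, ← Complex.exp_neg, ← integral_mul_const]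
  refine integral_congr_ae (.of_forall fun k => ?_)
  simp only [Real.inner_apply]
  rw [← Complex.exp_add]
  congr 1
  push_cast
  ring

open scoped NNReal in
/-- The central limit theorem for Poisson variables with mean tending to infinity. -/
theorem tendsto_standardizedPoisson {a : ℕ → ℝ≥0} (ha : Tendsto a atTop atTop) :
    Tendsto (fun n => standardizedPoisson (a n)) atTop
      (nhds ⟨gaussianReal 0 1, inferInstance⟩) := by
  refine ProbabilityMeasure.tendsto_of_tendsto_charFun fun t => ?_
  simp only [charFun_standardizedPoisson, ProbabilityMeasure.coe_mk, charFun_gaussianReal]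
  refine (Complex.continuous_exp.tendsto _).comp ?_
  have hs : Tendsto (fun n => √(a n : ℝ)) atTop atTop :=
    Real.tendsto_sqrt_atTop.comp (NNReal.tendsto_coe_atTop.2 ha)
  have hw : Tendsto (fun n => |t| / √(a n : ℝ)) atTop (nhds 0) := hs.const_div_atTop _
  have hbound : Tendsto (fun n => |t| ^ 2 * (|t| / √(a n : ℝ))) atTop (nhds 0) := by
    simpa only [mul_zero] using hw.const_mul (|t| ^ 2)
  rw [tendsto_iff_norm_sub_tendsto_zero]
  refine squeeze_zero' (.of_forall fun _ => norm_nonneg _) ?_ hbound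
  filter_upwards [hw.eventually (gt_mem_nhds one_pos), hs.eventually_gt_atTop 0] with n hn hpos
  have ha0 : (0 : ℝ) ≤ a n := (a n).2
  have hsq : √(a n : ℝ) ^ 2 = a n := Real.sq_sqrt ha0
  set s := √(a n : ℝ)
  set x : ℂ := ((t / s : ℝ) : ℂ) * Complex.I with hx
  have hxn : ‖x‖ = |t| / s := by
    rw [hx, norm_mul, Complex.norm_I, mul_one, Complex.norm_real, Real.norm_eq_abs, abs_div,
      abs_of_pos hpos]
  have hb := Complex.exp_bound (x := x) (by rw [hxn]; exact hn.le) (n := 3) (by norm_num)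
  have hsum : ∑ m ∈ range 3, x ^ m / (m.factorial : ℂ) = 1 + x + x ^ 2 / 2 := by
    simp [Finset.sum_range_succ]
  have hs0 : (s : ℂ) ≠ 0 := by exact_mod_cast hpos.ne'
  have hx2 : ((a n : ℝ) : ℂ) * (x ^ 2 / 2) = -(t ^ 2 / 2) := by
    rw [← hsq, hx, mul_pow, Complex.I_sq]
    push_cast
    field_simp
  have key : ((a n : ℝ) : ℂ) * (Complex.exp x - 1 - x) - (↑t * ↑(0:ℝ) * Complex.I - ↑((1:ℝ≥0):ℝ) * ↑t ^ 2 / 2)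
      = (a n : ℝ) * (Complex.exp x - ∑ m ∈ range 3, x ^ m / (m.factorial : ℂ)) := by
    rw [hsum]
    push_cast
    linear_combination hx2
  rw [key, norm_mul, Complex.norm_real, Real.norm_of_nonneg ha0]
  calc (a n : ℝ) * _ ≤ a n * (‖x‖ ^ 3 * 1) := by
        refine mul_le_mul_of_nonneg_left (hb.trans ?_) ha0
        refine mul_le_mul_of_nonneg_left ?_ (by positivity)
        norm_num [Nat.factorial]
    _ = |t| ^ 2 * (|t| / s) := by
        rw [hxn, ← hsq]
        field_simp

open scoped NNReal in
theorem tendsto_integral_pi_poissonMeasure {r : ℕ} {a : ℕ → Fin r → ℝ≥0}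
    (ha : ∀ i, Tendsto (fun n => a n i) atTop atTop)
    (φ : BoundedContinuousFunction (Fin r → ℝ) ℝ) :
    Tendsto (fun n => ∫ u : Fin r → ℕ, φ (fun i => ((u i : ℝ) - a n i) / √(a n i : ℝ))
        ∂Measure.pi fun i => poissonMeasure (a n i))
      atTop (nhds (∫ x, φ x ∂stdGaussian r)) := by
  have h := (ProbabilityMeasure.continuous_pi.tendsto
    (fun _ : Fin r => (⟨gaussianReal 0 1, inferInstance⟩ : ProbabilityMeasure ℝ))).comp
    (tendsto_pi_nhds.2 fun i => tendsto_standardizedPoisson (ha i))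
  rw [ProbabilityMeasure.tendsto_iff_forall_integral_tendsto] at h
  refine (h φ).congr fun n => ?_
  have hmap : ((ProbabilityMeasure.pi fun i => standardizedPoisson (a n i) :
      ProbabilityMeasure (Fin r → ℝ)) : Measure (Fin r → ℝ)) =
      (Measure.pi fun i => poissonMeasure (a n i)).map
        fun u i => ((u i : ℝ) - a n i) / √(a n i : ℝ) :=
    (Measure.pi_map_pi fun i => .of_discrete).symm
  change ∫ x, φ x ∂((ProbabilityMeasure.pi fun i => standardizedPoisson (a n i) :
      ProbabilityMeasure (Fin r → ℝ)) : Measure (Fin r → ℝ)) = _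
  rw [hmap, integral_map .of_discrete φ.continuous.aestronglyMeasurable]

theorem pow_div_factorial_succ (a : ℝ) (k : ℕ) :
    a ^ (k + 1) / (k + 1).factorial = a ^ k / k.factorial * (a / (k + 1)) := by
  rw [Nat.factorial_succ]
  push_cast
  field_simp
  ring

theorem poisson_weight_bounds_of_le_floor {a : ℝ} (ha : 0 < a) (d k : ℕ) (hk : k + d = ⌊a⌋₊) :
    a ^ k / k.factorial ≤ a ^ ⌊a⌋₊ / ⌊a⌋₊.factorial ∧
      (1 - ((k - a) ^ 2 + |k - a|) / a) * (a ^ ⌊a⌋₊ / ⌊a⌋₊.factorial) ≤ a ^ k / k.factorial := by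
  induction d generalizing k with
  | zero =>
    obtain rfl : k = ⌊a⌋₊ := hk
    refine ⟨le_rfl, mul_le_of_le_one_left (by positivity) ?_⟩
    rw [sub_le_self_iff]
    positivity
  | succ d ih =>
    obtain ⟨h1, h2⟩ := ih (k + 1) (by omega)
    have hka : ((k + 1 : ℕ) : ℝ) ≤ a :=
      (Nat.le_floor_iff ha.le).1 (by omega)
    set M := a ^ ⌊a⌋₊ / (⌊a⌋₊.factorial : ℝ)
    have hM : 0 < M := by positivity
    rw [pow_div_factorial_succ] at h1 h2
    set q := a ^ k / (k.factorial : ℝ)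
    have hq : 0 < q := by positivity
    push_cast at hka h2
    have hk1 : (0 : ℝ) < k + 1 := by positivity
    have hqe : q = q * (a / (k + 1)) * ((k + 1) / a) := by field_simp
    set p := q * (a / (k + 1))
    have hp : 0 < p := by positivity
    have hqp : q * a = p * (k + 1) := by rw [hqe]; field_simp
    rw [abs_of_nonpos (by linarith)] at h2 ⊢
    have h2' : (a - ((k + 1 - a) ^ 2 + -(k + 1 - a))) * M ≤ p * a := by
      have := mul_le_mul_of_nonneg_right h2 ha.le
      calc _ = (1 - ((k + 1 - a) ^ 2 + -(k + 1 - a)) / a) * M * a := by field_simp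
        _ ≤ _ := this
    constructor
    · rw [hqe]
      exact (mul_le_of_le_one_right hp.le (by rw [div_le_one ha]; exact hka)).trans h1
    · refine le_of_mul_le_mul_right (a := a) ?_ ha
      calc _ = (a - ((k - a) ^ 2 + -(k - a))) * M := by field_simp
        _ ≤ p * a - p * (a - (k + 1)) := by
          have := mul_le_mul_of_nonneg_right h1 (sub_nonneg.2 hka)
          nlinarith
        _ = q * a := by rw [hqp]; ring

theorem poisson_weight_bounds_of_floor_lt {a : ℝ} (ha : 0 < a) (k : ℕ) (hk : ⌊a⌋₊ + 1 ≤ k) :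
    a ^ k / k.factorial ≤ a ^ ⌊a⌋₊ / ⌊a⌋₊.factorial ∧
      (1 - ((k - a) ^ 2 + |k - a|) / a) * (a ^ ⌊a⌋₊ / ⌊a⌋₊.factorial) ≤ a ^ k / k.factorial := by
  have key (k : ℕ) (hk : ⌊a⌋₊ ≤ k) (q M B : ℝ) (hM : 0 < M) (hq : 0 < q) (hqM : q ≤ M)
      (hlow : (a - B) * M ≤ q * a) (hB : (k + 1 - a) + B ≤ (k + 1 - a) ^ 2 + (k + 1 - a)) :
      q * (a / (k + 1)) ≤ M ∧
        (1 - (((k + 1 : ℕ) - a) ^ 2 + |((k + 1 : ℕ) : ℝ) - a|) / a) * M ≤ q * (a / (k + 1)) := by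
    have hka : a < k + 1 := by
      have := Nat.lt_floor_add_one a
      have : (⌊a⌋₊ : ℝ) ≤ k := by exact_mod_cast hk
      linarith
    push_cast
    rw [abs_of_pos (by linarith)]
    constructor
    · exact (mul_le_of_le_one_right hq.le (by rw [div_le_one (by linarith)]; exact hka.le)).trans hqM
    · refine le_of_mul_le_mul_right (a := a) ?_ ha
      have h1 : q * a - q * (k + 1 - a) ≤ q * (a / (k + 1)) * a := by
        have : q * (a / (k + 1)) * a - (q * a - q * (k + 1 - a)) =
          q * ((k + 1 - a) ^ 2 / (k + 1)) := by field_simp; ring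
        have : 0 ≤ q * ((k + 1 - a) ^ 2 / (k + 1)) := by positivity
        linarith
      have h2 : q * (k + 1 - a) ≤ M * (k + 1 - a) :=
        mul_le_mul_of_nonneg_right hqM (by linarith)
      calc _ = (a - ((k + 1 - a) ^ 2 + (k + 1 - a))) * M := by field_simp
        _ ≤ q * a - q * (k + 1 - a) := by nlinarith
        _ ≤ _ := h1
  have hM : 0 < a ^ ⌊a⌋₊ / (⌊a⌋₊.factorial : ℝ) := by positivity
  induction k, hk using Nat.le_induction with
  | base =>
    rw [pow_div_factorial_succ]
    refine key _ le_rfl _ _ 0 hM hM le_rfl (by rw [sub_zero, mul_comm]) ?_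
    nlinarith
  | succ k hk ih =>
    have hka : a < k := (Nat.lt_floor_add_one a).trans_le (by exact_mod_cast hk)
    rw [abs_of_pos (by linarith)] at ih
    rw [pow_div_factorial_succ]
    refine key k (by omega) _ _ ((k - a) ^ 2 + (k - a)) hM (by positivity) ih.1 ?_ (by nlinarith)
    calc _ = (1 - ((k - a) ^ 2 + (k - a)) / a) * (a ^ ⌊a⌋₊ / ⌊a⌋₊.factorial) * a := by field_simp
      _ ≤ _ := mul_le_mul_of_nonneg_right ih.2 ha.le

/-- The Poisson weight `a ^ k / k!`, extended by zero to negative `k` and normalized by its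
maximal value, which is attained at `k = ⌊a⌋`. -/
noncomputable def poissonRatio (a : ℝ) (k : ℤ) : ℝ :=
  if 0 ≤ k then (a ^ k.toNat / k.toNat.factorial) / (a ^ ⌊a⌋₊ / ⌊a⌋₊.factorial) else 0

theorem poissonRatio_natCast (a : ℝ) (k : ℕ) :
    poissonRatio a k = (a ^ k / k.factorial) / (a ^ ⌊a⌋₊ / ⌊a⌋₊.factorial) := by
  simp [poissonRatio]

theorem poissonRatio_of_neg (a : ℝ) {k : ℤ} (hk : k < 0) : poissonRatio a k = 0 :=
  if_neg hk.not_ge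

theorem poisson_weight_bounds {a : ℝ} (ha : 0 < a) (k : ℕ) :
    a ^ k / k.factorial ≤ a ^ ⌊a⌋₊ / ⌊a⌋₊.factorial ∧
      (1 - ((k - a) ^ 2 + |k - a|) / a) * (a ^ ⌊a⌋₊ / ⌊a⌋₊.factorial) ≤ a ^ k / k.factorial := by
  rcases le_or_gt k ⌊a⌋₊ with hk | hk
  · exact poisson_weight_bounds_of_le_floor ha (⌊a⌋₊ - k) k (by omega)
  · exact poisson_weight_bounds_of_floor_lt ha k hk

theorem poissonRatio_nonneg {a : ℝ} (ha : 0 < a) (k : ℤ) : 0 ≤ poissonRatio a k := by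
  unfold poissonRatio
  split_ifs <;> positivity

theorem poissonRatio_le_one {a : ℝ} (ha : 0 < a) (k : ℤ) : poissonRatio a k ≤ 1 := by
  unfold poissonRatio
  split_ifs
  · exact div_le_one_of_le₀ (poisson_weight_bounds ha _).1 (by positivity)
  · exact zero_le_one

theorem one_sub_poissonRatio_le {a : ℝ} (ha : 0 < a) (k : ℤ) :
    1 - poissonRatio a k ≤ (2 * (k - a) ^ 2 + 1) / a := by
  have habs (t : ℝ) : t ^ 2 + |t| ≤ 2 * t ^ 2 + 1 := by
    nlinarith [sq_nonneg (|t| - 1), sq_abs t]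
  refine le_trans ?_ (div_le_div_of_nonneg_right (habs _) ha.le)
  rcases le_or_gt 0 k with hk | hk
  · lift k to ℕ using hk
    rw [poissonRatio_natCast, sub_le_comm, le_div_iff₀ (by positivity)]
    exact_mod_cast (poisson_weight_bounds ha k).2
  · rw [poissonRatio_of_neg a hk, sub_zero, le_div_iff₀ ha]
    have hk' : (k : ℝ) < 0 := by exact_mod_cast hk
    rw [abs_of_neg (by linarith)]
    nlinarith

/-- The number of bins with exactly `r` balls that is forced by the numbers `u i` of bins with
exactly `i < r` balls when the capacity is `r + 1`. -/
def almostFullBins (n N : ℕ) {r : ℕ} (u : Fin r → ℕ) : ℤ :=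
  (r + 1) * N - n - ∑ i : Fin r, ((r : ℤ) + 1 - i) * u i

/-- The number of bins with exactly `r + 1` balls that is forced by the numbers `u i` of bins with
exactly `i < r` balls when the capacity is `r + 1`. -/
def fullBins (n N : ℕ) {r : ℕ} (u : Fin r → ℕ) : ℤ :=
  N - ∑ i : Fin r, (u i : ℤ) - almostFullBins n N u

theorem eq_almostFullBins_and_eq_fullBins_iff {n N r : ℕ} (u : Fin r → ℕ) (y z : ℤ) :
    (y = almostFullBins n N u ∧ z = fullBins n N u) ↔
      ∑ i, (u i : ℤ) + y + z = N ∧ ∑ i : Fin r, (i : ℤ) * u i + r * y + (r + 1) * z = n := by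
  have hsum : ∑ i : Fin r, ((r : ℤ) + 1 - i) * u i =
      (r + 1) * ∑ i : Fin r, (u i : ℤ) - ∑ i : Fin r, (i : ℤ) * u i := by
    rw [mul_sum, ← sum_sub_distrib]
    exact sum_congr rfl fun i _ => by ring
  rw [fullBins, almostFullBins, hsum]
  constructor
  · rintro ⟨rfl, rfl⟩
    constructor <;> ring
  · rintro ⟨h1, h2⟩
    rw [← h1, ← h2]
    constructor <;> ring

theorem binCount_eq_almostFullBins_and_fullBins {n N r : ℕ} {f : Fin n → Fin N}
    (hf : f ∈ validPlacements n N (r + 1)) :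
    (binCount f r : ℤ) = almostFullBins n N (fun i : Fin r => binCount f i) ∧
      (binCount f (r + 1) : ℤ) = fullBins n N (fun i : Fin r => binCount f i) := by
  rw [eq_almostFullBins_and_eq_fullBins_iff]
  have h1 := sum_binCount hf
  have h2 := sum_mul_binCount hf
  simp only [Fin.sum_univ_castSucc, Fin.val_castSucc, Fin.val_last] at h1 h2
  exact ⟨by exact_mod_cast h1, by exact_mod_cast h2⟩

/-- The numbers of bins with at most `C - 2` balls have, up to a constant, a law given by
independent Poisson weights times a correction depending on the two remaining counts. -/
theorem exists_card_validPlacements_eq_mul {n N : ℕ} (r : ℕ) (hNpos : 0 < N) {μ : ℕ → ℝ}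
    {t G : ℝ} (ht : 0 < t) (hG : 0 < G) (hμ : ∀ m, μ m = N * t ^ m / (G * m.factorial)) :
    ∃ K : ℝ, 0 < K ∧ ∀ u : Fin r → ℕ,
      (#{f ∈ validPlacements n N (r + 1) | (fun i : Fin r => binCount f i) = u} : ℝ) =
        K * ((∏ i : Fin r, Real.exp (-μ i) * μ i ^ u i / (u i).factorial) *
          (poissonRatio (μ r) (almostFullBins n N u) *
            poissonRatio (μ (r + 1)) (fullBins n N u))) := by
  have hNpos' : (0 : ℝ) < N := by exact_mod_cast hNpos
  have hμpos : ∀ m, 0 < μ m := fun m => by rw [hμ]; positivity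
  have hMpos : ∀ m, 0 < μ m ^ ⌊μ m⌋₊ / (⌊μ m⌋₊.factorial : ℝ) := fun m => by
    have := hμpos m
    positivity
  refine ⟨n.factorial * N.factorial * (G / N) ^ N / t ^ n * (∏ i : Fin r, Real.exp (μ i)) *
    (μ r ^ ⌊μ r⌋₊ / (⌊μ r⌋₊.factorial : ℝ)) *
    (μ (r + 1) ^ ⌊μ (r + 1)⌋₊ / (⌊μ (r + 1)⌋₊.factorial : ℝ)), ?_, fun u => ?_⟩
  · have := hMpos r
    have := hMpos (r + 1)
    have : 0 < ∏ i : Fin r, Real.exp (μ i) := prod_pos fun i _ => Real.exp_pos _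
    positivity
  by_cases hneg : almostFullBins n N u < 0 ∨ fullBins n N u < 0
  · have hempty : ({f ∈ validPlacements n N (r + 1) | (fun i : Fin r => binCount f i) = u} :
        Finset (Fin n → Fin N)) = ∅ := by
      refine filter_eq_empty_iff.2 fun f hf hfu => ?_
      obtain ⟨h1, h2⟩ := binCount_eq_almostFullBins_and_fullBins hf
      rw [hfu] at h1 h2
      omega
    rw [hempty]
    rcases hneg with h | h <;> simp [poissonRatio_of_neg _ h]
  push Not at hneg
  obtain ⟨y, hy⟩ := Int.eq_ofNat_of_zero_le hneg.1
  obtain ⟨z, hz⟩ := Int.eq_ofNat_of_zero_le hneg.2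
  let x : Fin (r + 1 + 1) → ℕ := Fin.snoc (α := fun _ => ℕ) (Fin.snoc (α := fun _ => ℕ) u y) z
  obtain ⟨hsum, hwsum⟩ := (eq_almostFullBins_and_eq_fullBins_iff u (y : ℤ) z).1 ⟨hy.symm, hz.symm⟩
  have hxN : ∑ m, x m = N := by
    simp only [x, Fin.sum_univ_castSucc, Fin.snoc_castSucc, Fin.snoc_last]
    exact_mod_cast hsum
  have hxn : ∑ m : Fin (r + 1 + 1), (m : ℕ) * x m = n := by
    simp only [x, Fin.sum_univ_castSucc, Fin.snoc_castSucc, Fin.snoc_last, Fin.val_castSucc,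
      Fin.val_last]
    exact_mod_cast hwsum
  have hfilter : ({f ∈ validPlacements n N (r + 1) | (fun i : Fin r => binCount f i) = u} :
        Finset (Fin n → Fin N)) =
      {f ∈ validPlacements n N (r + 1) | ∀ m : Fin (r + 1 + 1), binCount f m = x m} := by
    refine filter_congr fun f hf => ?_
    constructor
    · rintro hfu
      obtain ⟨h1, h2⟩ := binCount_eq_almostFullBins_and_fullBins hf
      rw [hfu, hy] at h1
      rw [hfu, hz] at h2
      refine Fin.lastCases ?_ (Fin.lastCases ?_ fun i => ?_)
      · simpa [x] using h2
      · simpa [x] using h1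
      · simpa [x] using congrFun hfu i
    · intro hfx
      funext i
      simpa [x] using hfx i.castSucc.castSucc
  rw [hfilter, card_validPlacements_binCount_eq_prod x hxN hxn hNpos ht hG, hy, hz]
  simp only [← hμ, Fin.prod_univ_castSucc, Fin.val_castSucc, Fin.val_last]
  simp only [x, Fin.snoc_castSucc, Fin.snoc_last, poissonRatio_natCast]
  have hexp : (∏ i : Fin r, Real.exp (μ i)) *
      ∏ i : Fin r, Real.exp (-μ i) * μ i ^ u i / (u i).factorial =
      ∏ i : Fin r, μ i ^ u i / (u i).factorial := by
    rw [← prod_mul_distrib]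
    refine prod_congr rfl fun i _ => ?_
    rw [mul_div_assoc, ← mul_assoc, ← Real.exp_add, add_neg_cancel, Real.exp_zero, one_mul]
  rw [← hexp]
  have h1 := (hMpos r).ne'
  have h2 := (hMpos (r + 1)).ne'
  set M₁ := μ r ^ ⌊μ r⌋₊ / (⌊μ r⌋₊.factorial : ℝ)
  set M₂ := μ (r + 1) ^ ⌊μ (r + 1)⌋₊ / (⌊μ (r + 1)⌋₊.factorial : ℝ)
  field_simp

theorem sq_sum_mul_le {r : ℕ} (c d : Fin r → ℝ) {B : ℝ} (hc : ∀ i, |c i| ≤ B) :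
    (∑ i, c i * d i) ^ 2 ≤ r * B ^ 2 * ∑ i, d i ^ 2 := by
  calc (∑ i, c i * d i) ^ 2 ≤ (r : ℝ) * ∑ i, (c i * d i) ^ 2 := by
        simpa using sq_sum_le_card_mul_sum_sq (s := univ) (f := fun i => c i * d i)
    _ ≤ r * ∑ i, B ^ 2 * d i ^ 2 := by
        gcongr with i
        rw [mul_pow]
        exact mul_le_mul_of_nonneg_right (sq_le_sq.2 ((hc i).trans (le_abs_self B))) (sq_nonneg _)
    _ = _ := by rw [← mul_sum, mul_assoc]

/-- The correction factor is close to one when `u` is close to the vector of means. -/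
theorem one_sub_poissonRatio_mul_le {n N r : ℕ} {μ : ℕ → ℝ} (hμ : ∀ m, 0 < μ m)
    (hsum : ∑ m ∈ range (r + 2), μ m = N) (hwsum : ∑ m ∈ range (r + 2), m * μ m = n)
    (u : Fin r → ℕ) :
    1 - poissonRatio (μ r) (almostFullBins n N u) * poissonRatio (μ (r + 1)) (fullBins n N u) ≤
      (2 * (r * (r + 1) ^ 2 * ∑ i : Fin r, ((u i : ℝ) - μ i) ^ 2) + 1) *
        ((μ r)⁻¹ + (μ (r + 1))⁻¹) := by
  have hy : (almostFullBins n N u : ℝ) - μ r =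
      ∑ i : Fin r, ((i : ℝ) - (r + 1)) * ((u i : ℝ) - μ i) := by
    rw [sum_range_succ, sum_range_succ, ← Fin.sum_univ_eq_sum_range] at hsum
    rw [sum_range_succ, sum_range_succ, ← Fin.sum_univ_eq_sum_range (fun m => (m : ℝ) * μ m)]
      at hwsum
    rw [almostFullBins]
    push_cast at hwsum ⊢
    rw [← hsum, ← hwsum]
    have h1 : ∑ i : Fin r, ((r : ℝ) + 1 - i) * u i =
      -∑ i : Fin r, ((i : ℝ) - (r + 1)) * u i := by
      rw [← sum_neg_distrib]; exact sum_congr rfl fun i _ => by ring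
    have h2 : ∑ i : Fin r, ((i : ℝ) - (r + 1)) * ((u i : ℝ) - μ i) =
        ∑ i : Fin r, ((i : ℝ) - (r + 1)) * u i - ∑ i : Fin r, (i : ℝ) * μ i +
          (r + 1) * ∑ i : Fin r, μ i := by
      rw [mul_sum, ← sum_sub_distrib, ← sum_add_distrib]
      exact sum_congr rfl fun i _ => by ring
    rw [h1, h2]
    ring
  have hz : (fullBins n N u : ℝ) - μ (r + 1) =
      ∑ i : Fin r, ((r : ℝ) - i) * ((u i : ℝ) - μ i) := by
    rw [sum_range_succ, sum_range_succ, ← Fin.sum_univ_eq_sum_range] at hsum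
    have h1 : ∑ i : Fin r, ((r : ℝ) - i) * ((u i : ℝ) - μ i) =
        -(∑ i : Fin r, (u i : ℝ) - ∑ i : Fin r, μ i) -
          ∑ i : Fin r, ((i : ℝ) - (r + 1)) * ((u i : ℝ) - μ i) := by
      rw [← sum_sub_distrib, ← sum_neg_distrib, ← sum_sub_distrib]
      exact sum_congr rfl fun i _ => by ring
    rw [h1, ← hy, fullBins]
    push_cast
    rw [← hsum]
    ring
  have hi (i : Fin r) : (i : ℝ) + 1 ≤ r := by exact_mod_cast i.2
  have hi0 (i : Fin r) : (0 : ℝ) ≤ i := Nat.cast_nonneg _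
  have hy2 := sq_sum_mul_le (fun i : Fin r => (i : ℝ) - (r + 1)) (fun i => (u i : ℝ) - μ i)
    (B := r + 1) fun i => by
      rw [abs_le]
      constructor <;> linarith [hi i, hi0 i]
  have hz2 := sq_sum_mul_le (fun i : Fin r => (r : ℝ) - i) (fun i => (u i : ℝ) - μ i)
    (B := r + 1) fun i => by
      rw [abs_le]
      constructor <;> linarith [hi i, hi0 i]
  rw [← hy] at hy2
  rw [← hz] at hz2
  have h1 := one_sub_poissonRatio_le (hμ r) (almostFullBins n N u)
  have h2 := one_sub_poissonRatio_le (hμ (r + 1)) (fullBins n N u)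
  have h3 := mul_nonneg (sub_nonneg.2 (poissonRatio_le_one (hμ r) (almostFullBins n N u)))
    (sub_nonneg.2 (poissonRatio_le_one (hμ (r + 1)) (fullBins n N u)))
  set D := r * ((r : ℝ) + 1) ^ 2 * ∑ i : Fin r, ((u i : ℝ) - μ i) ^ 2
  have h4 : (2 * ((almostFullBins n N u : ℝ) - μ r) ^ 2 + 1) / μ r ≤ (2 * D + 1) * (μ r)⁻¹ := by
    rw [div_eq_mul_inv]
    have := inv_pos.2 (hμ r)
    gcongr
  have h5 : (2 * ((fullBins n N u : ℝ) - μ (r + 1)) ^ 2 + 1) / μ (r + 1) ≤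
      (2 * D + 1) * (μ (r + 1))⁻¹ := by
    rw [div_eq_mul_inv]
    have := inv_pos.2 (hμ (r + 1))
    gcongr
  rw [mul_add]
  linarith

theorem gfun_pos (C : ℕ) {x : ℝ} (hx : 0 < x) : 0 < gfun C x :=
  sum_pos (fun k _ => by positivity) ⟨0, by simp⟩

theorem gfun_mono (C : ℕ) {x y : ℝ} (hx : 0 ≤ x) (hxy : x ≤ y) : gfun C x ≤ gfun C y :=
  sum_le_sum fun k _ => by gcongr

theorem mul_deriv_gfun (C : ℕ) (x : ℝ) :
    x * deriv (gfun C) x = ∑ k ∈ range (C + 1), k * (x ^ k / k.factorial) := by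
  have h : HasDerivAt (gfun C)
      (∑ k ∈ range (C + 1), (k * x ^ (k - 1)) / (k.factorial : ℝ)) x :=
    HasDerivAt.fun_sum fun k _ => (hasDerivAt_pow k x).div_const _
  rw [h.deriv, mul_sum]
  refine sum_congr rfl fun k _ => ?_
  rcases k with _ | k
  · simp
  · rw [Nat.add_sub_cancel, pow_succ]
    ring

theorem gfun_le (C : ℕ) {x : ℝ} (hx : 1 ≤ x) : gfun C x ≤ (C + 1) * x ^ C := by
  calc gfun C x ≤ ∑ k ∈ range (C + 1), x ^ C := by
        refine sum_le_sum fun k hk => ?_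
        refine (div_le_self (by positivity) ?_).trans
          (pow_le_pow_right₀ hx (Nat.lt_succ_iff.1 (mem_range.1 hk)))
        exact_mod_cast k.factorial_pos
    _ = _ := by simp

/-- The saddle point satisfies `C ≤ (C - ρ) g(x)` when `x g'(x) / g(x) = ρ`. -/
theorem le_sub_mul_gfun (C : ℕ) {x ρ : ℝ} (hx : 0 < x)
    (h : x * deriv (gfun C) x / gfun C x = ρ) : (C : ℝ) ≤ (C - ρ) * gfun C x := by
  have hg := gfun_pos C hx
  rw [div_eq_iff hg.ne', mul_deriv_gfun] at h
  rw [sub_mul, ← h, gfun, mul_sum, ← sum_sub_distrib]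
  simp only [← sub_mul]
  have hnonneg : ∀ k ∈ range (C + 1), 0 ≤ ((C : ℝ) - k) * (x ^ k / k.factorial) := fun k hk => by
    have : (k : ℝ) ≤ C := by exact_mod_cast Nat.lt_succ_iff.1 (mem_range.1 hk)
    have := sub_nonneg.2 this
    positivity
  simpa using single_le_sum hnonneg (mem_range.2 C.succ_pos)

theorem tendsto_saddle_atTop {C : ℕ} (hC : 0 < C) {x ρ : ℕ → ℝ} (hx : ∀ ν, 0 < x ν)
    (h : ∀ ν, x ν * deriv (gfun C) (x ν) / gfun C (x ν) = ρ ν)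
    (hρ : Tendsto (fun ν => C - ρ ν) atTop (nhds 0)) : Tendsto x atTop atTop := by
  refine tendsto_atTop.2 fun B => ?_
  have hB : 0 < gfun C (max B 1) := gfun_pos C (by positivity)
  have hC' : (0 : ℝ) < C := by exact_mod_cast hC
  filter_upwards [hρ.eventually (gt_mem_nhds (div_pos hC' hB))] with ν hν
  by_contra! hlt
  have h1 := le_sub_mul_gfun C (hx ν) (h ν)
  have h2 : gfun C (x ν) ≤ gfun C (max B 1) := gfun_mono C (hx ν).le (hlt.le.trans (le_max_left _ _))
  have hg := gfun_pos C (hx ν)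
  rw [lt_div_iff₀ hB] at hν
  have h3 : 0 < (C - ρ ν) := by
    by_contra! hneg
    nlinarith
  nlinarith

theorem tendsto_mean_atTop {C : ℕ} (hC : 0 < C) {N : ℕ → ℕ} (hNpos : ∀ ν, 0 < N ν) {x : ℕ → ℝ}
    (hx : ∀ ν, 0 < x ν) (hxtop : Tendsto x atTop atTop)
    (hxN : Tendsto (fun ν => x ν / (N ν : ℝ) ^ ((1 : ℝ) / C)) atTop (nhds 0)) (m : ℕ) :
    Tendsto (fun ν => (N ν : ℝ) * x ν ^ m / (gfun C (x ν) * m.factorial)) atTop atTop := by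
  have h1 : Tendsto (fun ν => x ν ^ C / (N ν : ℝ)) atTop (nhds 0) := by
    have := hxN.pow C
    rw [zero_pow hC.ne'] at this
    refine this.congr fun ν => ?_
    rw [div_pow, ← Real.rpow_natCast ((N ν : ℝ) ^ _), ← Real.rpow_mul (Nat.cast_nonneg _),
      one_div_mul_cancel (by exact_mod_cast hC.ne'), Real.rpow_one]
  have h2 : Tendsto (fun ν => (N ν : ℝ) / x ν ^ C) atTop atTop := by
    have : Tendsto (fun ν => x ν ^ C / (N ν : ℝ)) atTop (nhdsWithin 0 (Set.Ioi 0)) :=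
      tendsto_nhdsWithin_iff.2 ⟨h1, .of_forall fun ν =>
        div_pos (pow_pos (hx ν) _) (by exact_mod_cast hNpos ν)⟩
    refine this.inv_tendsto_nhdsGT_zero.congr fun ν => ?_
    simp
  have h3 := h2.atTop_div_const (r := ((C : ℝ) + 1) * m.factorial) (by positivity)
  refine tendsto_atTop_mono' _ ?_ h3
  filter_upwards [hxtop.eventually_ge_atTop 1] with ν hν
  have hg := gfun_pos C (hx ν)
  have hx0 := hx ν
  rw [div_div, div_le_div_iff₀ (by positivity) (by positivity)]
  have hle := gfun_le C hν
  have hpow : 1 ≤ x ν ^ m := one_le_pow₀ hν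
  calc (N ν : ℝ) * (gfun C (x ν) * m.factorial)
      ≤ N ν * (((C + 1) * x ν ^ C) * m.factorial) := by gcongr
    _ ≤ N ν * (((C + 1) * x ν ^ C) * m.factorial) * x ν ^ m :=
        le_mul_of_one_le_right (by positivity) hpow
    _ = _ := by ring

theorem tendsto_mean_div_mean {C : ℕ} {N : ℕ → ℕ} (hNpos : ∀ ν, 0 < N ν) {x : ℕ → ℝ}
    (hx : ∀ ν, 0 < x ν) (hxtop : Tendsto x atTop atTop) {m M : ℕ} (hmM : m < M) :
    Tendsto (fun ν => ((N ν : ℝ) * x ν ^ m / (gfun C (x ν) * m.factorial)) /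
      ((N ν : ℝ) * x ν ^ M / (gfun C (x ν) * M.factorial))) atTop (nhds 0) := by
  have h := ((tendsto_pow_atTop (Nat.sub_ne_zero_of_lt hmM)).comp hxtop).const_div_atTop
    ((M.factorial : ℝ) / m.factorial)
  refine h.congr fun ν => ?_
  have hg := gfun_pos C (hx ν)
  have hx0 := hx ν
  have hN : (0 : ℝ) < N ν := by exact_mod_cast hNpos ν
  obtain ⟨d, rfl⟩ := Nat.exists_eq_add_of_lt hmM
  simp only [Function.comp_apply]
  rw [show m + d + 1 - m = d + 1 by omega, show m + d + 1 = m + (d + 1) by omega, pow_add]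
  field_simp
  ring

theorem tendsto_integral_mul_div_integral {α : Type*} [MeasurableSpace α]
    {P : ℕ → Measure α} [∀ ν, IsProbabilityMeasure (P ν)] {ψ h : ℕ → α → ℝ} {B L : ℝ}
    (hψm : ∀ ν, AEStronglyMeasurable (ψ ν) (P ν)) (hhm : ∀ ν, AEStronglyMeasurable (h ν) (P ν))
    (hψB : ∀ ν a, ‖ψ ν a‖ ≤ B) (h0 : ∀ ν a, 0 ≤ h ν a) (h1 : ∀ ν a, h ν a ≤ 1)
    (hh : Tendsto (fun ν => ∫ a, (1 - h ν a) ∂P ν) atTop (nhds 0))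
    (hψ : Tendsto (fun ν => ∫ a, ψ ν a ∂P ν) atTop (nhds L)) :
    Tendsto (fun ν => (∫ a, ψ ν a * h ν a ∂P ν) / ∫ a, h ν a ∂P ν) atTop (nhds L) := by
  have hψi : ∀ ν, Integrable (ψ ν) (P ν) := fun ν =>
    .of_bound (hψm ν) B (.of_forall (hψB ν))
  have hhi : ∀ ν, Integrable (h ν) (P ν) := fun ν =>
    .of_bound (hhm ν) 1 (.of_forall fun a => by
      rw [Real.norm_of_nonneg (h0 ν a)]; exact h1 ν a)
  have hci : ∀ ν, Integrable (fun a => 1 - h ν a) (P ν) := fun ν =>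
    (integrable_const 1).sub (hhi ν)
  have hpi : ∀ ν, Integrable (fun a => ψ ν a * (1 - h ν a)) (P ν) := fun ν =>
    (hci ν).bdd_mul (hψm ν) (.of_forall (hψB ν))
  have hden : Tendsto (fun ν => ∫ a, h ν a ∂P ν) atTop (nhds 1) := by
    have := hh.const_sub 1
    rw [sub_zero] at this
    refine this.congr fun ν => ?_
    rw [integral_sub (integrable_const 1) (hhi ν)]
    simp
  have herr : Tendsto (fun ν => ∫ a, ψ ν a * (1 - h ν a) ∂P ν) atTop (nhds 0) := by
    have hB : Tendsto (fun ν => B * ∫ a, (1 - h ν a) ∂P ν) atTop (nhds 0) := by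
      simpa using hh.const_mul B
    refine squeeze_zero_norm (fun ν => ?_) hB
    rw [← integral_const_mul]
    refine norm_integral_le_of_norm_le ((hci ν).const_mul B) (.of_forall fun a => ?_)
    have hnn := sub_nonneg.2 (h1 ν a)
    rw [norm_mul, Real.norm_of_nonneg hnn]
    exact mul_le_mul_of_nonneg_right (hψB ν a) hnn
  have hnum : Tendsto (fun ν => ∫ a, ψ ν a * h ν a ∂P ν) atTop (nhds L) := by
    have := hψ.sub herr
    rw [sub_zero] at this
    refine this.congr fun ν => ?_
    rw [← integral_sub (hψi ν) (hpi ν)]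
    exact integral_congr_ae (.of_forall fun a => by ring)
  have hdiv := hnum.div hden one_ne_zero
  rw [div_one] at hdiv
  exact hdiv

/-- Summing over placements a function of the numbers of bins with at most `r - 1` balls. -/
theorem sum_validPlacements_eq_mul_integral {n N r : ℕ} {a : Fin r → NNReal}
    {h : (Fin r → ℕ) → ℝ} {K : ℝ} (hK : 0 < K)
    (ha : ∀ i, 0 < a i)
    (hcard : ∀ u : Fin r → ℕ,
      (#{f ∈ validPlacements n N (r + 1) | (fun i : Fin r => binCount f i) = u} : ℝ) =
        K * ((∏ i : Fin r, Real.exp (-a i) * (a i : ℝ) ^ u i / (u i).factorial) * h u))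
    (ψ : (Fin r → ℕ) → ℝ)
    (hint : Integrable (fun u => ψ u * h u) (Measure.pi fun i => poissonMeasure (a i))) :
    ∑ f ∈ validPlacements n N (r + 1), ψ (fun i => binCount f i) =
      K * ∫ u, ψ u * h u ∂Measure.pi fun i => poissonMeasure (a i) := by
  classical
  set U := (validPlacements n N (r + 1)).image fun f (i : Fin r) => binCount f i with hU
  have hreal : ∀ u : Fin r → ℕ, (Measure.pi fun i => poissonMeasure (a i)).real {u} =
      ∏ i : Fin r, Real.exp (-a i) * (a i : ℝ) ^ u i / (u i).factorial := fun u => by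
    rw [measureReal_def, Measure.pi_singleton, ENNReal.toReal_prod]
    exact prod_congr rfl fun i _ => poissonMeasure_real_singleton _ _
  have hzero : ∀ u, u ∉ U → h u = 0 := fun u hu => by
    have hempty : ({f ∈ validPlacements n N (r + 1) | (fun i : Fin r => binCount f i) = u} :
        Finset (Fin n → Fin N)) = ∅ :=
      filter_eq_empty_iff.2 fun f hf hfu => hu (mem_image.2 ⟨f, hf, hfu⟩)
    have h1 := hcard u
    rw [hempty, card_empty, Nat.cast_zero, zero_eq_mul] at h1
    have hpos : 0 < ∏ i : Fin r, Real.exp (-a i) * (a i : ℝ) ^ u i / ((u i).factorial : ℝ) :=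
      prod_pos fun i _ => by
        have : (0 : ℝ) < a i := ha i
        positivity
    exact (mul_eq_zero.1 (h1.resolve_left hK.ne')).resolve_left hpos.ne'
  rw [integral_countable hint, tsum_eq_sum (s := U) fun u hu => by simp [hzero u hu], mul_sum,
    ← sum_fiberwise_of_maps_to (t := U) (g := fun f (i : Fin r) => binCount f i)
      fun f hf => mem_image_of_mem _ hf]
  refine sum_congr rfl fun u _ => ?_
  rw [sum_congr rfl (g := fun _ => ψ u) (fun f hf => by rw [(mem_filter.1 hf).2]), sum_const,
    nsmul_eq_mul, hreal, smul_eq_mul]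
  rw [hcard u]
  ring

theorem integrable_pi_poissonMeasure_sq_sub {r : ℕ} (a : Fin r → NNReal) (i : Fin r) :
    Integrable (fun u : Fin r → ℕ => ((u i : ℝ) - a i) ^ 2)
      (Measure.pi fun i => poissonMeasure (a i)) :=
  integrable_comp_eval (μ := fun i => poissonMeasure (a i)) (integrable_poissonMeasure_sq_sub (a i))

theorem integral_pi_poissonMeasure_sq_sub {r : ℕ} (a : Fin r → NNReal) (i : Fin r) :
    ∫ u : Fin r → ℕ, ((u i : ℝ) - a i) ^ 2 ∂(Measure.pi fun i => poissonMeasure (a i)) = a i := by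
  rw [integral_comp_eval (μ := fun i => poissonMeasure (a i)) (i := i)
    (f := fun k : ℕ => ((k : ℝ) - a i) ^ 2) .of_discrete, integral_poissonMeasure_sq_sub]

theorem sum_mean_eq (C : ℕ) {N : ℕ} {x : ℝ} (hx : 0 < x) :
    ∑ m ∈ range (C + 1), N * x ^ m / (gfun C x * m.factorial) = N := by
  have hg := (gfun_pos C hx).ne'
  calc _ = N / gfun C x * gfun C x := by
        rw [gfun, mul_sum]
        exact sum_congr rfl fun m _ => by ring
    _ = N := div_mul_cancel₀ _ hg

theorem sum_mul_mean_eq (C : ℕ) {n N : ℕ} (hN : 0 < N) {x : ℝ}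
    (h : x * deriv (gfun C) x / gfun C x = (n : ℝ) / N) :
    ∑ m ∈ range (C + 1), m * (N * x ^ m / (gfun C x * m.factorial)) = n := by
  have hN' : (N : ℝ) ≠ 0 := by exact_mod_cast hN.ne'
  calc _ = N * (x * deriv (gfun C) x / gfun C x) := by
        rw [mul_deriv_gfun, sum_div, mul_sum]
        exact sum_congr rfl fun m _ => by ring
    _ = n := by rw [h, mul_div_cancel₀ _ hN']

/-- The correction factor relating the law of the numbers of bins with at most `C - 2` balls to
independent Poisson variables. -/
noncomputable def poissonCorrection (n N : ℕ) {r : ℕ} (μ : ℕ → ℝ) (u : Fin r → ℕ) : ℝ :=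
  poissonRatio (μ r) (almostFullBins n N u) * poissonRatio (μ (r + 1)) (fullBins n N u)

theorem poissonCorrection_nonneg {n N r : ℕ} {μ : ℕ → ℝ} (hμ : ∀ m, 0 < μ m) (u : Fin r → ℕ) :
    0 ≤ poissonCorrection n N μ u :=
  mul_nonneg (poissonRatio_nonneg (hμ _) _) (poissonRatio_nonneg (hμ _) _)

theorem poissonCorrection_le_one {n N r : ℕ} {μ : ℕ → ℝ} (hμ : ∀ m, 0 < μ m) (u : Fin r → ℕ) :
    poissonCorrection n N μ u ≤ 1 :=
  mul_le_one₀ (poissonRatio_le_one (hμ _) _) (poissonRatio_nonneg (hμ _) _)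
    (poissonRatio_le_one (hμ _) _)

theorem integrable_mul_poissonCorrection {n N r : ℕ} {μ : ℕ → ℝ} (hμ : ∀ m, 0 < μ m)
    (P : Measure (Fin r → ℕ)) [IsProbabilityMeasure P] {ψ : (Fin r → ℕ) → ℝ} {B : ℝ}
    (hψ : ∀ u, ‖ψ u‖ ≤ B) : Integrable (fun u => ψ u * poissonCorrection n N μ u) P :=
  .of_bound .of_discrete B (.of_forall fun u => by
    rw [norm_mul, Real.norm_of_nonneg (poissonCorrection_nonneg hμ u)]
    exact (mul_le_of_le_one_right (norm_nonneg _) (poissonCorrection_le_one hμ u)).trans (hψ u))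

theorem integral_one_sub_poissonCorrection_le {n N r : ℕ} {μ : ℕ → ℝ} (hμ : ∀ m, 0 < μ m)
    (hsum : ∑ m ∈ range (r + 2), μ m = N) (hwsum : ∑ m ∈ range (r + 2), m * μ m = n) :
    ∫ u : Fin r → ℕ, (1 - poissonCorrection n N μ u)
      ∂(Measure.pi fun i : Fin r => poissonMeasure (μ i).toNNReal) ≤
      (2 * (r * (r + 1) ^ 2 * ∑ i : Fin r, μ i) + 1) * ((μ r)⁻¹ + (μ (r + 1))⁻¹) := by
  set P := Measure.pi fun i : Fin r => poissonMeasure (μ i).toNNReal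
  have hcoe (i : Fin r) : (((μ i).toNNReal : NNReal) : ℝ) = μ i := Real.coe_toNNReal _ (hμ i).le
  have hint (i : Fin r) : Integrable (fun u : Fin r → ℕ => ((u i : ℝ) - μ i) ^ 2) P := by
    simpa only [hcoe] using integrable_pi_poissonMeasure_sq_sub (fun i => (μ i).toNNReal) i
  have hval (i : Fin r) : ∫ u : Fin r → ℕ, ((u i : ℝ) - μ i) ^ 2 ∂P = μ i := by
    simpa only [hcoe] using integral_pi_poissonMeasure_sq_sub (fun i => (μ i).toNNReal) i
  have hsumint : Integrable (fun u : Fin r → ℕ => ∑ i, ((u i : ℝ) - μ i) ^ 2) P :=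
    integrable_finsetSum _ fun i _ => hint i
  have hD := ((hsumint.const_mul (r * ((r : ℝ) + 1) ^ 2)).const_mul 2)
  have hcint : Integrable (fun u : Fin r → ℕ => poissonCorrection n N μ u) P := by
    simpa using integrable_mul_poissonCorrection (n := n) (N := N) hμ P (ψ := fun _ => 1) (B := 1)
      (by simp)
  refine (integral_mono ((integrable_const 1).sub hcint)
    ((hD.add (integrable_const 1)).mul_const _)
    fun u => one_sub_poissonRatio_mul_le hμ hsum hwsum u).trans_eq ?_
  simp only [Pi.add_apply]
  rw [integral_mul_const, integral_add hD (integrable_const 1), integral_const_mul,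
    integral_const_mul, integral_finsetSum _ fun i _ => hint i]
  simp [hval]

theorem placement_average_eq {n N : ℕ} (r : ℕ) (hN : 0 < N) {μ : ℕ → ℝ} {t G : ℝ} (ht : 0 < t)
    (hG : 0 < G) (hμ : ∀ m, μ m = N * t ^ m / (G * m.factorial)) {ψ : (Fin r → ℕ) → ℝ} {B : ℝ}
    (hψ : ∀ u, ‖ψ u‖ ≤ B) :
    (∑ f ∈ validPlacements n N (r + 1), ψ (fun i => binCount f i)) /
        ((validPlacements n N (r + 1)).card : ℝ) =
      (∫ u, ψ u * poissonCorrection n N μ u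
        ∂(Measure.pi fun i : Fin r => poissonMeasure (μ i).toNNReal)) /
      ∫ u : Fin r → ℕ, poissonCorrection n N μ u
        ∂(Measure.pi fun i : Fin r => poissonMeasure (μ i).toNNReal) := by
  have hN' : (0 : ℝ) < N := by exact_mod_cast hN
  have hμpos : ∀ m, 0 < μ m := fun m => by rw [hμ]; positivity
  have hcoe (i : Fin r) : (((μ i).toNNReal : NNReal) : ℝ) = μ i :=
    Real.coe_toNNReal _ (hμpos i).le
  obtain ⟨K, hK, hcard⟩ := exists_card_validPlacements_eq_mul (n := n) r hN ht hG hμ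
  have key {ψ : (Fin r → ℕ) → ℝ} {B : ℝ} (hψ : ∀ u, ‖ψ u‖ ≤ B) :=
    sum_validPlacements_eq_mul_integral (n := n) (N := N)
      (a := fun i : Fin r => (μ i).toNNReal) (h := poissonCorrection n N μ) hK
      (fun i => Real.toNNReal_pos.2 (hμpos i))
      (fun u => by simpa only [hcoe, poissonCorrection] using hcard u) ψ
      (integrable_mul_poissonCorrection hμpos _ hψ)
  have hone := key (ψ := fun _ => 1) (B := 1) (by simp)
  simp only [sum_const, nsmul_eq_mul, mul_one, one_mul] at hone
  rw [key hψ, hone, mul_div_mul_left _ _ hK.ne']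

theorem tendsto_placement_average (r : ℕ) (n N : ℕ → ℕ) (hNpos : ∀ ν, 0 < N ν)
    (hhigh : ∀ ν, n ν ≤ (r + 1) * N ν)
    (hgap : Tendsto (fun ν => (((r + 1) * N ν - n ν : ℕ) : ℝ) / N ν) atTop (nhds 0))
    (x : ℕ → ℝ) (hx : ∀ ν, 0 < x ν)
    (hsaddle : ∀ ν, x ν * deriv (gfun (r + 1)) (x ν) / gfun (r + 1) (x ν) = (n ν : ℝ) / N ν)
    (hxN : Tendsto (fun ν => x ν / (N ν : ℝ) ^ ((1 : ℝ) / (r + 1 : ℕ))) atTop (nhds 0))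
    (μ : ℕ → ℕ → ℝ)
    (hμ : ∀ ν m, μ ν m = (N ν : ℝ) * x ν ^ m / (gfun (r + 1) (x ν) * m.factorial))
    (φ : BoundedContinuousFunction (Fin r → ℝ) ℝ) :
    Tendsto (fun ν =>
        (∑ f ∈ validPlacements (n ν) (N ν) (r + 1),
            φ (fun i => ((binCount f (i : ℕ) : ℝ) - μ ν i) / √(μ ν i))) /
          ((validPlacements (n ν) (N ν) (r + 1)).card : ℝ))
      atTop (nhds (∫ y, φ y ∂stdGaussian r)) := by
  have hg : ∀ ν, 0 < gfun (r + 1) (x ν) := fun ν => gfun_pos _ (hx ν)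
  have hμpos : ∀ ν m, 0 < μ ν m := fun ν m => by
    have := hg ν
    have := hx ν
    have : (0 : ℝ) < N ν := by exact_mod_cast hNpos ν
    rw [hμ]
    positivity
  have hxtop : Tendsto x atTop atTop := by
    refine tendsto_saddle_atTop (Nat.succ_pos r) hx hsaddle (hgap.congr fun ν => ?_)
    have : (N ν : ℝ) ≠ 0 := by exact_mod_cast (hNpos ν).ne'
    rw [Nat.cast_sub (hhigh ν), sub_div, Nat.cast_mul, mul_div_cancel_right₀ _ this]
  have hμtop (m : ℕ) : Tendsto (fun ν => μ ν m) atTop atTop := by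
    simpa only [hμ] using tendsto_mean_atTop (Nat.succ_pos r) hNpos hx hxtop hxN m
  have hμratio {m M : ℕ} (hmM : m < M) : Tendsto (fun ν => μ ν m * (μ ν M)⁻¹) atTop (nhds 0) := by
    simpa only [hμ, div_eq_mul_inv] using
      tendsto_mean_div_mean (C := r + 1) hNpos hx hxtop hmM
  have hcoe (ν : ℕ) (i : Fin r) : (((μ ν i).toNNReal : NNReal) : ℝ) = μ ν i :=
    Real.coe_toNNReal _ (hμpos ν i).le
  have hclose : Tendsto (fun ν => ∫ u : Fin r → ℕ, (1 - poissonCorrection (n ν) (N ν) (μ ν) u)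
      ∂(Measure.pi fun i : Fin r => poissonMeasure (μ ν i).toNNReal)) atTop (nhds 0) := by
    have hbound (M : ℕ) (hM : r ≤ M) : Tendsto (fun ν =>
        (2 * (r * (r + 1) ^ 2 * ∑ i : Fin r, μ ν i) + 1) * (μ ν M)⁻¹) atTop (nhds 0) := by
      have h1 : Tendsto (fun ν => ∑ i : Fin r, μ ν i * (μ ν M)⁻¹) atTop (nhds 0) := by
        simpa using tendsto_finsetSum (univ : Finset (Fin r))
          fun i _ => hμratio (lt_of_lt_of_le i.2 hM)
      have h2 := (h1.const_mul (2 * (r * ((r : ℝ) + 1) ^ 2))).add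
        (tendsto_inv_atTop_zero.comp (hμtop M))
      rw [mul_zero, add_zero] at h2
      refine h2.congr fun ν => ?_
      rw [Function.comp_apply, ← sum_mul]
      ring
    have hsumbound := (hbound r le_rfl).add (hbound (r + 1) (Nat.le_succ r))
    rw [add_zero] at hsumbound
    refine squeeze_zero (fun ν => integral_nonneg fun u =>
      sub_nonneg.2 (poissonCorrection_le_one (hμpos ν) u)) (fun ν => ?_) hsumbound
    rw [← mul_add]
    refine integral_one_sub_poissonCorrection_le (hμpos ν) ?_ ?_
    · simpa only [hμ] using sum_mean_eq (r + 1) (hx ν)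
    · simpa only [hμ] using sum_mul_mean_eq (r + 1) (hNpos ν) (hsaddle ν)
  have hpoisson : Tendsto (fun ν => ∫ u : Fin r → ℕ,
      φ (fun i => ((u i : ℝ) - μ ν i) / √(μ ν i))
        ∂(Measure.pi fun i : Fin r => poissonMeasure (μ ν i).toNNReal))
      atTop (nhds (∫ y, φ y ∂stdGaussian r)) := by
    have h := tendsto_integral_pi_poissonMeasure (a := fun ν (i : Fin r) => (μ ν i).toNNReal)
      (fun i => tendsto_real_toNNReal_atTop.comp (hμtop i)) φ
    simpa only [hcoe] using h
  refine (tendsto_integral_mul_div_integral (fun ν => .of_discrete) (fun ν => .of_discrete)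
    (fun ν u => φ.norm_coe_le_norm _) (fun ν u => poissonCorrection_nonneg (hμpos ν) u)
    (fun ν u => poissonCorrection_le_one (hμpos ν) u) hclose hpoisson).congr fun ν => ?_
  exact (placement_average_eq r (hNpos ν) (hx ν) (hg ν) (hμ ν)
    (ψ := fun u => φ fun i => ((u i : ℝ) - μ ν i) / √(μ ν i))
    fun u => φ.norm_coe_le_norm _).symm

/-- **Theorem (joint CLT for the numbers of bins containing at most `C−2` balls).**
Fix `C ≥ 2`. If `N → ∞`, `n ≤ CN − 1`, `CN − n = o(N)` and `λ₀ = o(N^{1/C})`, where `λ₀`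
is the unique positive solution of `λ g'(λ)/g(λ) = n/N`, and `μ_m = N λ₀^m/(g(λ₀) m!)`,
then in the uniform allocation model the random vector `((X_m − μ_m)/√μ_m)_{m=0}^{C−2}`
converges in distribution to `N(0, I_{C−1})`: the numbers of bins containing exactly `m`
balls, `0 ≤ m ≤ C−2`, are asymptotically independent Gaussians. -/
theorem statement15 (C : ℕ) (hC : 2 ≤ C)
    (n N : ℕ → ℕ) (hNpos : ∀ ν, 0 < N ν)
    (hN : Tendsto N atTop atTop)
    (hhigh : ∀ ν, n ν ≤ C * N ν - 1)
    (hgap : Tendsto (fun ν => ((C * N ν - n ν : ℕ) : ℝ) / N ν) atTop (nhds 0))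
    (lam0 : ℕ → ℝ) (hlam0pos : ∀ ν, 0 < lam0 ν)
    (hlam0 : ∀ ν, lam0 ν * deriv (gfun C) (lam0 ν) / gfun C (lam0 ν) = (n ν : ℝ) / N ν)
    (hlamN : Tendsto (fun ν => lam0 ν / (N ν : ℝ) ^ ((1 : ℝ) / C)) atTop (nhds 0))
    (μ : ℕ → ℕ → ℝ)
    (hμ : ∀ ν m, μ ν m = (N ν : ℝ) * lam0 ν ^ m / (gfun C (lam0 ν) * Nat.factorial m)) :
    ∀ φ : BoundedContinuousFunction (Fin (C - 1) → ℝ) ℝ,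
      Tendsto (fun ν =>
          (∑ f ∈ validPlacements (n ν) (N ν) C,
              φ (fun i => ((binCount f (i : ℕ) : ℝ) - μ ν i) / Real.sqrt (μ ν i))) /
            ((validPlacements (n ν) (N ν) C).card : ℝ))
        atTop (nhds (∫ x, φ x ∂ stdGaussian (C - 1))) := by
  obtain ⟨r, rfl⟩ : ∃ r, C = r + 1 := ⟨C - 1, by omega⟩
  exact tendsto_placement_average r n N hNpos (fun ν => (hhigh ν).trans (Nat.sub_le _ _)) hgap
    lam0 hlam0pos hlam0 hlamN μ hμ
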